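/- In the specific 3-buyer second-price auction with interdependent valuations given by v 1 1 = 2, v 1 2 = 1, v 1 3 = 0; v 2 1 = 0, v 2 2 = 4, v 2 3 = 1; v 3 1 = 0, v 3 2 = 1, v 3 3 = 6 (ties broken in favor of the lowest-index buyer), no strategy of Buyer 2 survives the iterative deletion of weakly dominated strategies: for every bid b ∈ [0,∞) of Buyer 2 there exists a valid sequence of iterative deletions of weakly dominated strategies and a step τ of it with b ∉ S_2^τ. -/

import Mathlib

/-- The winner of the auction: among the buyers with maximal bid, the winner is the one
with the lowest index. -/
noncomputable def winnerLow {n : ℕ} (b : Fin (n + 1) → ℝ) : Fin (n + 1) :=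
  (Finset.univ.filter fun i => ∀ j, b j ≤ b i).min' (by
    obtain ⟨i, -, hi⟩ := Finset.exists_max_image (Finset.univ : Finset (Fin (n + 1))) b
      ⟨0, Finset.mem_univ 0⟩
    exact ⟨i, Finset.mem_filter.mpr ⟨Finset.mem_univ i, fun j => hi j (Finset.mem_univ j)⟩⟩)

/-- The maximum bid among the buyers other than `w`. -/
noncomputable def secondPrice {n : ℕ} (b : Fin (n + 1) → ℝ) (w : Fin (n + 1)) : ℝ :=
  if h : (Finset.univ.erase w).Nonempty then (Finset.univ.erase w).sup' h b else 0

/-- Buyer `i`'s utility in the second-price auction with interdependent valuations `v`: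
if `i` wins it gets `v i i` minus the maximum bid of the other buyers, and if `j ≠ i`
wins then buyer `i` gets `v i j`. -/
noncomputable def utilSP {n : ℕ} (v : Fin (n + 1) → Fin (n + 1) → ℝ) (i : Fin (n + 1))
    (b : Fin (n + 1) → ℝ) : ℝ :=
  if i = winnerLow b then v i (winnerLow b) - secondPrice b (winnerLow b)
  else v i (winnerLow b)

/-- `s'` weakly dominates `s` for buyer `i` (with utility `u`) relative to the strategy
sets `S j` of the opponents `j ≠ i`. -/
def WeaklyDominates {n : ℕ} (u : (Fin (n + 1) → ℝ) → ℝ) (i : Fin (n + 1))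
    (S : Fin (n + 1) → Set ℝ) (s' s : ℝ) : Prop :=
  (∀ b : Fin (n + 1) → ℝ, (∀ j, j ≠ i → b j ∈ S j) →
    u (Function.update b i s) ≤ u (Function.update b i s')) ∧
  (∃ b : Fin (n + 1) → ℝ, (∀ j, j ≠ i → b j ∈ S j) ∧
    u (Function.update b i s) < u (Function.update b i s'))


/-- The specific interdependent valuations: buyers `0, 1, 2` stand for Buyers `1, 2, 3`;
`v 0 = (2, 1, 0)`, `v 1 = (0, 4, 1)`, `v 2 = (0, 1, 6)`. -/
noncomputable def vA : Fin 3 → Fin 3 → ℝ := ![![2, 1, 0], ![0, 4, 1], ![0, 1, 6]]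

/-- `ValidSeq v L S` : `S 0, S 1, …, S L` is a valid sequence for the iterative deletion
of weakly dominated strategies: every buyer starts with strategy set `[0, ∞)` and at each
step `1 ≤ τ ≤ L` one buyer `i` has its strategy set strictly shrunk (all other buyers'
sets are unchanged), where every deleted bid is weakly dominated, relative to the current
sets of the others, by some surviving bid. -/
def ValidSeq (v : Fin 3 → Fin 3 → ℝ) (L : ℕ) (S : ℕ → Fin 3 → Set ℝ) : Prop :=
  (∀ i, S 0 i = Set.Ici 0) ∧
  ∀ τ, 1 ≤ τ → τ ≤ L → ∃ i : Fin 3,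
    (∀ j, j ≠ i → S τ j = S (τ - 1) j) ∧
    S τ i ⊂ S (τ - 1) i ∧
    ∀ s ∈ S (τ - 1) i \ S τ i, ∃ s' ∈ S τ i, WeaklyDominates (utilSP v i) i (S τ) s' s

theorem winnerLow_fin_three (b : Fin 3 → ℝ) :
    winnerLow b = if b 1 ≤ b 0 ∧ b 2 ≤ b 0 then 0 else if b 2 ≤ b 1 then 1 else 2 := by
  have hmem : ∀ j, b j ≤ b (winnerLow b) :=
    (Finset.mem_filter.mp (Finset.min'_mem (Finset.univ.filter fun i => ∀ j, b j ≤ b i) _)).2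
  have hle : ∀ i, (∀ j, b j ≤ b i) → winnerLow b ≤ i := fun i hi =>
    Finset.min'_le _ _ (Finset.mem_filter.mpr ⟨Finset.mem_univ i, hi⟩)
  have h0 := hmem 0
  have h1 := hmem 1
  have h2 := hmem 2
  have g0 := hle 0
  have g1 := hle 1
  simp only [Fin.forall_fin_succ, Fin.forall_fin_zero, Fin.succ_zero_eq_one,
    Fin.succ_one_eq_two] at g0 g1
  generalize winnerLow b = w at *
  split_ifs with p q
  · simpa using g0 ⟨le_rfl, p.1, p.2, trivial⟩
  · fin_cases w
    · exact absurd ⟨h1, h2⟩ p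
    · rfl
    · refine absurd (g1 ⟨?_, le_rfl, q, trivial⟩) (by decide)
      simp at h0 h1
      linarith
  · fin_cases w
    · exact absurd ⟨h1, h2⟩ p
    · exact absurd h2 q
    · rfl

theorem secondPrice_fin_three (b : Fin 3 → ℝ) :
    secondPrice b 0 = max (b 1) (b 2) ∧ secondPrice b 1 = max (b 0) (b 2) ∧
      secondPrice b 2 = max (b 0) (b 1) := by
  have e0 : (Finset.univ.erase (0 : Fin 3)) = {1, 2} := by decide
  have e1 : (Finset.univ.erase (1 : Fin 3)) = {0, 2} := by decide
  have e2 : (Finset.univ.erase (2 : Fin 3)) = {0, 1} := by decide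
  simp [secondPrice, e0, e1, e2]

theorem utilSP_vA_zero (b : Fin 3 → ℝ) :
    utilSP vA 0 b = if b 1 ≤ b 0 ∧ b 2 ≤ b 0 then 2 - max (b 1) (b 2)
      else if b 2 ≤ b 1 then 1 else 0 := by
  rw [utilSP, winnerLow_fin_three]
  split_ifs <;> simp_all [vA, secondPrice_fin_three]

theorem utilSP_vA_one (b : Fin 3 → ℝ) :
    utilSP vA 1 b = if b 1 ≤ b 0 ∧ b 2 ≤ b 0 then 0
      else if b 2 ≤ b 1 then 4 - max (b 0) (b 2) else 1 := by
  rw [utilSP, winnerLow_fin_three]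
  split_ifs <;> simp_all [vA, secondPrice_fin_three]

theorem utilSP_vA_two (b : Fin 3 → ℝ) :
    utilSP vA 2 b = if b 1 ≤ b 0 ∧ b 2 ≤ b 0 then 0
      else if b 2 ≤ b 1 then 1 else 6 - max (b 0) (b 1) := by
  rw [utilSP, winnerLow_fin_three]
  split_ifs <;> simp_all [vA, secondPrice_fin_three]

/-- Weak dominance for buyer `i` does not depend on the strategy set of buyer `i`. -/
theorem WeaklyDominates.congr {n : ℕ} {u : (Fin (n + 1) → ℝ) → ℝ} {i : Fin (n + 1)}
    {S S' : Fin (n + 1) → Set ℝ} {s' s : ℝ} (h : WeaklyDominates u i S s' s)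
    (hS : ∀ j, j ≠ i → S' j = S j) : WeaklyDominates u i S' s' s := by
  refine ⟨fun b hb => h.1 b fun j hj => hS j hj ▸ hb j hj, ?_⟩
  obtain ⟨b, hb, hlt⟩ := h.2
  exact ⟨b, fun j hj => (hS j hj).symm ▸ hb j hj, hlt⟩

/-- If buyer `i ≠ 1` may first shrink its strategy set to `T`, and `b` is weakly dominated
for buyer `1` afterwards, then `b` is deleted in some valid sequence. -/
theorem exists_validSeq_notMem {v : Fin 3 → Fin 3 → ℝ} {i : Fin 3} (hi : i ≠ 1) {T : Set ℝ}
    (hT : T ⊂ Set.Ici 0)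
    (hdom : ∀ s ∈ Set.Ici 0 \ T, ∃ s' ∈ T,
      WeaklyDominates (utilSP v i) i (fun _ => Set.Ici 0) s' s)
    {b b' : ℝ} (hb : 0 ≤ b) (hb' : 0 ≤ b') (hne : b' ≠ b)
    (h : WeaklyDominates (utilSP v 1) 1 (Function.update (fun _ => Set.Ici 0) i T) b' b) :
    ∃ (L : ℕ) (S : ℕ → Fin 3 → Set ℝ) (τ : ℕ), ValidSeq v L S ∧ τ ≤ L ∧ b ∉ S τ 1 := by
  let S₁ : Fin 3 → Set ℝ := Function.update (fun _ => Set.Ici 0) i T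
  let S₂ : Fin 3 → Set ℝ := Function.update S₁ 1 (Set.Ici 0 \ {b})
  have hS₁ : S₁ 1 = Set.Ici 0 := Function.update_of_ne hi.symm _ _
  have hS₁i : S₁ i = T := Function.update_self _ _ _
  have hS₂ : S₂ 1 = Set.Ici 0 \ {b} := Function.update_self _ _ _
  refine ⟨2, fun | 0 => fun _ => Set.Ici 0 | 1 => S₁ | _ => S₂, 2, ⟨fun _ => rfl, ?_⟩, le_rfl, ?_⟩
  · intro τ h1 h2
    interval_cases τ
    · have hS : ∀ j, j ≠ i → S₁ j = Set.Ici 0 := fun j hj => Function.update_of_ne hj _ _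
      refine ⟨i, hS, by simpa only [hS₁i] using hT, fun s hs => ?_⟩
      simp only [hS₁i] at hs ⊢
      obtain ⟨s', hs', hd⟩ := hdom s hs
      exact ⟨s', hs', hd.congr hS⟩
    · have hS : ∀ j, j ≠ 1 → S₂ j = S₁ j := fun j hj => Function.update_of_ne hj _ _
      refine ⟨1, hS, ?_, fun s hs => ?_⟩
      · simp only [hS₁, hS₂]
        exact ⟨Set.sdiff_subset, fun hsub => (hsub (Set.mem_Ici.mpr hb)).2 rfl⟩
      · simp only [hS₁, hS₂] at hs ⊢
        obtain rfl : s = b := by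
          by_contra hsb
          exact hs.2 ⟨hs.1, hsb⟩
        exact ⟨b', ⟨hb', hne⟩, h.congr hS⟩
  · simp [hS₂]

/-- Bidding `2` weakly dominates any higher bid of buyer `0`. -/
theorem weaklyDominates_zero {s : ℝ} (hs : 2 < s) :
    WeaklyDominates (utilSP vA 0) 0 (fun _ => Set.Ici 0) 2 s := by
  constructor
  · intro b _
    simp [utilSP_vA_zero]
    grind
  · refine ⟨![0, s, 0], ?_, ?_⟩
    · intro j _
      fin_cases j <;> simp
      linarith
    · simp [utilSP_vA_zero]
      grind

/-- Bidding `5` weakly dominates any lower bid of buyer `2`. -/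
theorem weaklyDominates_two {s : ℝ} (hs₀ : 0 ≤ s) (hs : s < 5) :
    WeaklyDominates (utilSP vA 2) 2 (fun _ => Set.Ici 0) 5 s := by
  constructor
  · intro b _
    simp [utilSP_vA_two]
    grind
  · refine ⟨![s, 0, 0], ?_, ?_⟩
    · intro j _
      fin_cases j <;> simp
      linarith
    · simp [utilSP_vA_two]
      grind

/-- Once buyer `0` bids at most `2`, bidding `3` weakly dominates any higher bid of
buyer `1`. -/
theorem weaklyDominates_one_of_gt {s : ℝ} (hs : 3 < s) :
    WeaklyDominates (utilSP vA 1) 1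
      (Function.update (fun _ => Set.Ici 0) 0 (Set.Icc 0 2)) 3 s := by
  constructor
  · intro b hb
    have h0 := hb 0 (by decide)
    simp at h0
    simp [utilSP_vA_one]
    grind
  · refine ⟨![0, 0, s], ?_, ?_⟩
    · intro j _
      fin_cases j <;> simp [Function.update]
      linarith
    · simp [utilSP_vA_one]
      grind

/-- Once buyer `2` does not bid in `(3, 4]`, bidding `4` weakly dominates any bid of
buyer `1` that is at most `3`. -/
theorem weaklyDominates_one_of_le {s : ℝ} (hs : s ≤ 3) :
    WeaklyDominates (utilSP vA 1) 1
      (Function.update (fun _ => Set.Ici 0) 2 (Set.Ici 0 \ Set.Ioc 3 4)) 4 s := by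
  constructor
  · intro b hb
    have h2 := hb 2 (by decide)
    simp at h2
    simp [utilSP_vA_one]
    grind
  · refine ⟨![7 / 2, 0, 0], ?_, ?_⟩
    · intro j _
      fin_cases j <;> simp [Function.update]
      norm_num
    · simp [utilSP_vA_one]
      grind

/-- In the specific 3-buyer second-price auction `vA` (ties broken in favor of the lowest
index), no strategy of Buyer 2 (index 1) survives the iterative deletion of weakly
dominated strategies: for every bid `b ∈ [0, ∞)` there is a valid sequence of iterative
deletions and a step `τ` of it at which `b` has been deleted from Buyer 2's set. -/
theorem stmt9 :
    ∀ b : ℝ, 0 ≤ b → ∃ (L : ℕ) (S : ℕ → Fin 3 → Set ℝ) (τ : ℕ),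
      ValidSeq vA L S ∧ τ ≤ L ∧ b ∉ S τ 1 := by
  intro b hb
  rcases le_or_gt b 3 with h | h
  · refine exists_validSeq_notMem (i := 2) (T := Set.Ici 0 \ Set.Ioc 3 4) (by decide) ?_ ?_ hb
      (by norm_num) (by linarith) (weaklyDominates_one_of_le h)
    · refine ⟨Set.sdiff_subset, fun hsub => ?_⟩
      have h4 : (4 : ℝ) ∈ Set.Ici 0 \ Set.Ioc 3 4 := hsub (by simp)
      exact h4.2 (by norm_num)
    · rintro s ⟨hs, hsT⟩
      have hs4 : s ≤ 4 := by
        by_contra hlt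
        exact hsT ⟨hs, fun hmem => hlt hmem.2⟩
      exact ⟨5, by norm_num, weaklyDominates_two hs (by linarith)⟩
  · refine exists_validSeq_notMem (i := 0) (T := Set.Icc 0 2) (by decide) ?_ ?_ hb
      (by norm_num) (by linarith) (weaklyDominates_one_of_gt h)
    · refine ⟨fun x hx => hx.1, fun hsub => ?_⟩
      have h3 : (3 : ℝ) ∈ Set.Icc 0 2 := hsub (by simp)
      linarith [h3.2]
    · rintro s ⟨hs, hsT⟩
      exact ⟨2, by norm_num, weaklyDominates_zero (not_le.mp fun hle => hsT ⟨hs, hle⟩)⟩
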